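/- arXiv:1111.3705 — 2 statements merged into one kernel-verified Lean document; each statement's English description precedes it below -/
import Mathlib

section
/- Let ρ: G → GL_d(ℂ) be a representation with d ≥ 1 and let S(q) be the (n+1)×(n+1) Molien matrix over ℂ(q) with entries S(q)^i_j = (1/|G|) Σ_{k=0}^n |C_k|·χ_i(g_k)·conj(χ_j(g_k)) / det(1 − q·ρ(g_k)). Let n_1, …, n_d be positive integers and suppose that every entry of the matrix D(q) := (Π_{t=1}^d (1 − q^{n_t})) · S(q) is a polynomial in ℂ[q]. Let B be the (n+1)×(n+1) complex matrix with entries B^i_j = (1/|G|) Σ_{k=0}^n |C_k|·χ_i(g_k)·conj(χ_j(g_k))·det(1 − ρ(g_k)). Then D^{(d)}(1)·B^{d+1} = (−1)^d · d! · (n_1·n_2⋯n_d) · B^d, where D^{(d)}(1) is the entrywise d-th derivative of D(q) evaluated at q = 1. -/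
open CategoryTheory
open scoped Classical

/-- The size of the conjugacy class of `x`. -/
noncomputable def classCard {G : Type*} [Group G] (x : G) : ℕ :=
  Nat.card {y : G // IsConj x y}

/-- `det(1 − q·ρ(g))` as an element of the field `ℂ(q)` of rational functions. -/
noncomputable def molienDetRat {G : Type} [Group G] {d : ℕ}
    (ρ : G →* Matrix.GeneralLinearGroup (Fin d) ℂ) (s : G) : RatFunc ℂ :=
  Matrix.det ((1 : Matrix (Fin d) (Fin d) (RatFunc ℂ)) -
    ((ρ s : Matrix (Fin d) (Fin d) ℂ)).map fun a => RatFunc.X * RatFunc.C a)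

open Polynomial in
/-- If `f * h = ∏ (1 - X ^ nₜ)` over `d` factors and `h 1 ≠ 0`, then `f` vanishes to order `d` at `1`
with the expected leading coefficient. -/
theorem eval_iterate_derivative_of_mul_eq_prod_one_sub_X_pow {d : ℕ} (nn : Fin d → ℕ)
    {f h : ℂ[X]} (hfh : f * h = ∏ t, (1 - X ^ nn t)) (h1 : h.eval 1 ≠ 0) :
    eval 1 (derivative^[d] f) * h.eval 1 =
      (-1) ^ d * (Nat.factorial d : ℂ) * ∏ t, (nn t : ℂ) := by
  set Q : ℂ[X] := ∏ t, -(∑ i ∈ Finset.range (nn t), X ^ i) with hQ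
  have hP : f * h = (X - C 1) ^ d * Q := by
    have (t : Fin d) : (1 - X ^ nn t : ℂ[X]) =
        (X - C 1) * -(∑ i ∈ Finset.range (nn t), X ^ i) := by
      rw [mul_neg, C_1, mul_geom_sum, neg_sub]
    rw [hfh, Finset.prod_congr rfl fun t _ => this t, Finset.prod_mul_distrib]
    simp [hQ]
  have hcop : IsCoprime ((X - C 1 : ℂ[X]) ^ d) h := by
    refine IsCoprime.pow_left ((irreducible_X_sub_C (1 : ℂ)).coprime_iff_not_dvd.2 ?_)
    rwa [dvd_iff_isRoot]
  obtain ⟨F, rfl⟩ : (X - C 1) ^ d ∣ f := hcop.dvd_of_dvd_mul_right (hP ▸ dvd_mul_right _ _)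
  have hF : F * h = Q := by
    refine mul_left_cancel₀ (pow_ne_zero d (X_sub_C_ne_zero (1 : ℂ))) ?_
    rw [← hP, mul_assoc]
  have hder := aeval_iterate_derivative_self ((X - C 1) ^ d * F) d (1 : ℂ) (p' := F) (by simp)
  rw [coe_aeval_eq_eval] at hder
  have hQ1 : eval 1 Q = (-1) ^ d * ∏ t, (nn t : ℂ) := by
    rw [hQ, eval_prod]
    simp [eval_finsetSum, Finset.prod_neg]
  rw [hder, nsmul_eq_mul, mul_assoc, ← eval_mul, hF, hQ1]
  ring

open scoped ComplexOrder in
open Matrix in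
/-- The trace of a complex matrix representation of a finite group at an inverse. -/
theorem Matrix.trace_map_inv_eq_star {G m : Type*} [Group G] [Fintype G] [Fintype m]
    [DecidableEq m] (A : G →* Matrix m m ℂ) (x : G) :
    (A x⁻¹).trace = star (A x).trace := by
  set H : Matrix m m ℂ := ∑ y, (A y)ᴴ * A y with hH
  have hpos : H.PosDef := by
    rw [hH, ← Finset.add_sum_erase _ _ (Finset.mem_univ (1 : G))]
    refine PosDef.add_posSemidef ?_
      (posSemidef_sum _ fun y _ => posSemidef_conjTranspose_mul_self (A y))
    rw [map_one, conjTranspose_one, one_mul]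
    exact PosDef.one
  have hinv : (A x)ᴴ * H * A x = H := by
    rw [hH, Finset.mul_sum, Finset.sum_mul]
    refine Fintype.sum_equiv (Equiv.mulRight x) _ _ fun y => ?_
    simp [conjTranspose_mul, Matrix.mul_assoc]
  have hx : A x * A x⁻¹ = 1 := by rw [← map_mul, mul_inv_cancel, map_one]
  have hdet : IsUnit H.det := (isUnit_iff_isUnit_det H).1 hpos.isUnit
  have key : A x⁻¹ = H⁻¹ * ((A x)ᴴ * H) := by
    have : H * A x⁻¹ = (A x)ᴴ * H := by
      conv_lhs => rw [← hinv]
      rw [Matrix.mul_assoc, hx, Matrix.mul_one]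
    rw [← this, nonsing_inv_mul_cancel_left _ _ hdet]
  rw [key, trace_mul_comm, Matrix.mul_assoc, mul_nonsing_inv _ hdet, Matrix.mul_one,
    trace_conjTranspose]

theorem FDRep.character_inv_eq_conj {G : Type} [Group G] [Fintype G] (V : FDRep ℂ G) (x : G) :
    V.character x⁻¹ = starRingEnd ℂ (V.character x) := by
  let b := Module.finBasis ℂ V
  have h := Matrix.trace_map_inv_eq_star
    ((MonoidHomClass.toMonoidHom (LinearMap.toMatrixAlgEquiv b)).comp V.ρ) x
  have ht (y : G) : V.character y = (LinearMap.toMatrix b b (V.ρ y)).trace :=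
    LinearMap.trace_eq_matrix_trace ℂ b _
  rw [ht, ht]
  exact h

/-- Summing a class function over the group, one conjugacy class at a time. -/
theorem sum_classCard_mul {G : Type*} [Group G] [Fintype G] {ι : Type*} [Fintype ι] (g : ι → G)
    (hg : ∀ x : G, ∃! k, IsConj (g k) x) (f : G → ℂ)
    (hf : ∀ x y, IsConj x y → f x = f y) :
    ∑ k, (classCard (g k) : ℂ) * f (g k) = ∑ x, f x := by
  choose c hc hu using hg
  rw [← Finset.sum_fiberwise _ c f]
  refine Finset.sum_congr rfl fun k _ => ?_
  have hmem (x : G) : c x = k ↔ IsConj (g k) x :=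
    ⟨fun h => h ▸ hc x, fun h => (hu x k h).symm⟩
  rw [Finset.sum_congr rfl (g := fun _ => f (g k)), Finset.sum_const, nsmul_eq_mul]
  · simp only [classCard, hmem, Nat.card_eq_fintype_card, Fintype.card_subtype]
  · intro x hx
    exact (hf _ _ ((hmem x).1 (Finset.mem_filter.1 hx).2)).symm

theorem FDRep.sum_classCard_mul_character {G : Type} [Group G] [Fintype G] {ι : Type*} [Fintype ι]
    (g : ι → G) (hg : ∀ x : G, ∃! k, IsConj (g k) x) (V W : FDRep ℂ G) [Simple V] [Simple W] :
    (Fintype.card G : ℂ)⁻¹ * ∑ k, (classCard (g k) : ℂ) *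
      (V.character (g k) * starRingEnd ℂ (W.character (g k))) =
        if Nonempty (V ≅ W) then 1 else 0 := by
  have hne : (Nat.card G : ℂ) ≠ 0 := by simp
  have : Invertible (Nat.card G : ℂ) := invertibleOfNonzero hne
  have hconj (U : FDRep ℂ G) {x y : G} (h : IsConj x y) : U.character x = U.character y := by
    obtain ⟨z, rfl⟩ := isConj_iff.1 h
    rw [FDRep.char_conj]
  rw [sum_classCard_mul g hg (fun x => V.character x * starRingEnd ℂ (W.character x))
    fun x y h => by rw [hconj V h, hconj W h]]
  rw [← FDRep.char_orthonormal V W, Nat.card_eq_fintype_card]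
  simp_rw [FDRep.character_inv_eq_conj]

theorem algebraMap_charpolyRev {G : Type} [Group G] {d : ℕ}
    (ρ : G →* Matrix.GeneralLinearGroup (Fin d) ℂ) (x : G) :
    algebraMap (Polynomial ℂ) (RatFunc ℂ) (ρ x : Matrix (Fin d) (Fin d) ℂ).charpolyRev =
      molienDetRat ρ x := by
  rw [Matrix.charpolyRev, molienDetRat, RingHom.map_det]
  congr 1
  ext i j
  simp [Matrix.one_apply, apply_ite]
  exact mul_comm _ _

theorem Matrix.eval_one_charpolyRev {m R : Type*} [Fintype m] [DecidableEq m] [CommRing R]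
    (M : Matrix m m R) : M.charpolyRev.eval 1 = (1 - M).det := by
  rw [Matrix.charpolyRev, ← Polynomial.coe_evalRingHom, RingHom.map_det]
  congr 1
  ext i j
  simp [Matrix.one_apply, apply_ite]

/-- A polynomial matrix that becomes `U * diagonal r * V` over `ℂ(q)`, with `U V` inverse constant
matrices, is already diagonalised by `U` and `V` over `ℂ[q]`. -/
theorem exists_eq_mul_diagonal_mul {m : Type*} [Fintype m] [DecidableEq m]
    {U V : Matrix m m ℂ} (hUV : U * V = 1) (D : Matrix m m (Polynomial ℂ)) (r : m → RatFunc ℂ)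
    (hD : D.map (algebraMap (Polynomial ℂ) (RatFunc ℂ)) =
      U.map RatFunc.C * Matrix.diagonal r * V.map RatFunc.C) :
    ∃ e : m → Polynomial ℂ, (∀ k, algebraMap (Polynomial ℂ) (RatFunc ℂ) (e k) = r k) ∧
      D = U.map Polynomial.C * Matrix.diagonal e * V.map Polynomial.C := by
  have hVU : V * U = 1 := mul_eq_one_comm.1 hUV
  have hUV' : U.map Polynomial.C * V.map Polynomial.C = 1 := by
    rw [← Matrix.map_mul, hUV, Matrix.map_one _ (map_zero _) (map_one _)]
  have hVU' : V.map RatFunc.C * U.map RatFunc.C = 1 := by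
    rw [← Matrix.map_mul, hVU, Matrix.map_one _ (map_zero _) (map_one _)]
  have hC (M : Matrix m m ℂ) :
      (M.map Polynomial.C).map (algebraMap (Polynomial ℂ) (RatFunc ℂ)) = M.map RatFunc.C := by
    ext i j
    simp
  set E := V.map Polynomial.C * D * U.map Polynomial.C with hE
  have hEr : E.map (algebraMap (Polynomial ℂ) (RatFunc ℂ)) = Matrix.diagonal r := by
    rw [hE, Matrix.map_mul, Matrix.map_mul, hC, hC, hD]
    simp only [Matrix.mul_assoc, hVU', Matrix.mul_one]
    rw [← Matrix.mul_assoc, hVU', Matrix.one_mul]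
  have hEd : E = Matrix.diagonal fun k => E k k := by
    ext1 i j
    by_cases hij : i = j
    · subst hij
      simp
    · rw [Matrix.diagonal_apply_ne _ hij]
      have := congrFun (congrFun hEr i) j
      rw [Matrix.diagonal_apply_ne _ hij, Matrix.map_apply] at this
      exact (map_eq_zero_iff _ (RatFunc.algebraMap_injective ℂ)).1 this
  refine ⟨fun k => E k k, fun k => ?_, ?_⟩
  · simpa using congrFun (congrFun hEr k) k
  · rw [← hEd, hE]
    simp only [Matrix.mul_assoc, hUV', Matrix.mul_one]
    rw [← Matrix.mul_assoc, hUV', Matrix.one_mul]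

theorem Matrix.mul_diagonal_mul_pow {m R : Type*} [Fintype m] [DecidableEq m] [CommRing R]
    {U V : Matrix m m R} (hVU : V * U = 1) (hUV : U * V = 1) (δ : m → R) (N : ℕ) :
    (U * Matrix.diagonal δ * V) ^ N = U * Matrix.diagonal (fun k => δ k ^ N) * V := by
  induction N with
  | zero => simp [hUV]
  | succ N ih =>
    rw [pow_succ, ih]
    simp only [Matrix.mul_assoc]
    rw [← Matrix.mul_assoc V, hVU, Matrix.one_mul, ← Matrix.mul_assoc (Matrix.diagonal _),
      Matrix.diagonal_mul_diagonal]
    simp only [pow_succ]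

theorem stmt10 {G : Type} [Group G] [Fintype G] {n : ℕ}
    (g : Fin (n + 1) → G) (hg1 : g 0 = 1)
    (hg : ∀ x : G, ∃! k : Fin (n + 1), IsConj (g k) x)
    (R : Fin (n + 1) → FDRep ℂ G)
    (hsimple : ∀ i, Simple (R i))
    (htriv : ∀ x : G, (R 0).character x = 1)
    (hdist : ∀ i j, i ≠ j → ¬ Nonempty (R i ≅ R j))
    {d : ℕ} (hd : 1 ≤ d) (ρ : G →* Matrix.GeneralLinearGroup (Fin d) ℂ)
    -- `S` : the Molien matrix of `ρ` over `ℂ(q)`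
    (S : Fin (n + 1) → Fin (n + 1) → RatFunc ℂ)
    (hS : ∀ i j, S i j =
      RatFunc.C ((Fintype.card G : ℂ)⁻¹) *
        ∑ k : Fin (n + 1), (classCard (g k) : RatFunc ℂ) *
          RatFunc.C ((R i).character (g k)) *
          RatFunc.C ((starRingEnd ℂ) ((R j).character (g k))) / molienDetRat ρ (g k))
    (nn : Fin d → ℕ) (hnn : ∀ t, 0 < nn t)
    -- every entry of `D(q) = (Π_t (1 − q^{n_t})) · S(q)` is a polynomial
    (D : Matrix (Fin (n + 1)) (Fin (n + 1)) (Polynomial ℂ))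
    (hD : ∀ i j, algebraMap (Polynomial ℂ) (RatFunc ℂ) (D i j) =
      (∏ t : Fin d, ((1 : RatFunc ℂ) - RatFunc.X ^ nn t)) * S i j)
    -- `B` : the affine Cartan-type matrix, the value at `q = 1` of the graded
    -- Clebsch–Gordan matrix of the alternating sum of the exterior powers of `ρ`
    (B : Matrix (Fin (n + 1)) (Fin (n + 1)) ℂ)
    (hB : ∀ i j, B i j =
      (Fintype.card G : ℂ)⁻¹ *
        ∑ k : Fin (n + 1), (classCard (g k) : ℂ) *
          (R i).character (g k) * (starRingEnd ℂ) ((R j).character (g k)) *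
          Matrix.det ((1 : Matrix (Fin d) (Fin d) ℂ) - (ρ (g k) : Matrix (Fin d) (Fin d) ℂ))) :
    (Matrix.of fun a b : Fin (n + 1) =>
        Polynomial.eval 1 ((⇑Polynomial.derivative)^[d] (D a b))) * B ^ (d + 1) =
      ((-1 : ℂ) ^ d * (Nat.factorial d : ℂ) * ∏ t : Fin d, (nn t : ℂ)) • B ^ d := by
  set U : Matrix (Fin (n + 1)) (Fin (n + 1)) ℂ :=
    Matrix.of fun i k => (R i).character (g k) with hU
  set V : Matrix (Fin (n + 1)) (Fin (n + 1)) ℂ :=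
    Matrix.of fun k j => (Fintype.card G : ℂ)⁻¹ * (classCard (g k) : ℂ) *
      starRingEnd ℂ ((R j).character (g k)) with hV
  have hUV : U * V = 1 := by
    ext i j
    have h := FDRep.sum_classCard_mul_character g hg (R i) (R j)
    have hij : Nonempty (R i ≅ R j) ↔ i = j :=
      ⟨fun h => by_contra fun hne => hdist i j hne h, fun h => h ▸ ⟨Iso.refl _⟩⟩
    simp only [hij] at h
    rw [Matrix.one_apply, ← h, Matrix.mul_apply, Finset.mul_sum]
    refine Finset.sum_congr rfl fun k _ => ?_
    simp only [hU, hV, Matrix.of_apply]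
    ring
  have hVU : V * U = 1 := mul_eq_one_comm.1 hUV
  set δ : Fin (n + 1) → ℂ :=
    fun k => Matrix.det ((1 : Matrix (Fin d) (Fin d) ℂ) - (ρ (g k) : Matrix (Fin d) (Fin d) ℂ))
    with hδ
  have hBd : B = U * Matrix.diagonal δ * V := by
    ext i j
    rw [hB, Matrix.mul_apply, Finset.mul_sum]
    refine Finset.sum_congr rfl fun k _ => ?_
    rw [Matrix.mul_diagonal]
    simp only [hU, hV, hδ, Matrix.of_apply]
    ring
  obtain ⟨e, he, hDe⟩ := exists_eq_mul_diagonal_mul hUV D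
    (fun k => (∏ t : Fin d, ((1 : RatFunc ℂ) - RatFunc.X ^ nn t)) / molienDetRat ρ (g k)) (by
      ext i j
      rw [Matrix.map_apply, hD, hS, Matrix.mul_apply, Finset.mul_sum, Finset.mul_sum]
      refine Finset.sum_congr rfl fun k _ => ?_
      rw [Matrix.mul_diagonal]
      simp only [hU, hV, Matrix.of_apply, Matrix.map_apply, map_mul, map_natCast]
      ring)
  have hprod (k : Fin (n + 1)) :
      e k * (ρ (g k) : Matrix (Fin d) (Fin d) ℂ).charpolyRev =
        ∏ t, (1 - Polynomial.X ^ nn t) := by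
    have hne : molienDetRat ρ (g k) ≠ 0 := by
      rw [← algebraMap_charpolyRev, ne_eq, map_eq_zero_iff _ (RatFunc.algebraMap_injective ℂ)]
      intro h0
      simpa [h0] using Matrix.eval_charpolyRev (M := (ρ (g k) : Matrix (Fin d) (Fin d) ℂ))
    apply RatFunc.algebraMap_injective ℂ
    rw [map_mul, he, algebraMap_charpolyRev, div_mul_cancel₀ _ hne]
    simp
  set ε : Fin (n + 1) → ℂ := fun k => Polynomial.eval 1 (Polynomial.derivative^[d] (e k)) with hε
  have hL : (Matrix.of fun a b : Fin (n + 1) =>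
      Polynomial.eval 1 ((⇑Polynomial.derivative)^[d] (D a b))) =
        U * Matrix.diagonal ε * V := by
    ext a b
    rw [Matrix.of_apply, hDe, Matrix.mul_apply, Matrix.mul_apply,
      Polynomial.iterate_derivative_sum, Polynomial.eval_finsetSum]
    refine Finset.sum_congr rfl fun k _ => ?_
    rw [Matrix.mul_diagonal, Matrix.mul_diagonal, Matrix.map_apply, Matrix.map_apply,
      mul_assoc, Polynomial.iterate_derivative_C_mul, mul_comm (e k),
      Polynomial.iterate_derivative_C_mul]
    simp only [Polynomial.eval_mul, Polynomial.eval_C, hε]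
    ring
  have hεδ (k : Fin (n + 1)) : ε k * δ k ^ (d + 1) =
      ((-1 : ℂ) ^ d * (Nat.factorial d : ℂ) * ∏ t : Fin d, (nn t : ℂ)) * δ k ^ d := by
    by_cases h0 : δ k = 0
    · simp [h0, (Nat.one_le_iff_ne_zero.1 hd)]
    · have h1 := Matrix.eval_one_charpolyRev (ρ (g k) : Matrix (Fin d) (Fin d) ℂ)
      have := eval_iterate_derivative_of_mul_eq_prod_one_sub_X_pow nn (hprod k) (h1 ▸ h0)
      rw [h1] at this
      rw [← this, pow_succ']
      ring
  rw [hL, hBd, Matrix.mul_diagonal_mul_pow hVU hUV, Matrix.mul_diagonal_mul_pow hVU hUV]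
  simp only [Matrix.mul_assoc]
  rw [← Matrix.mul_assoc V, hVU, Matrix.one_mul, ← Matrix.mul_assoc (Matrix.diagonal ε),
    Matrix.diagonal_mul_diagonal]
  simp only [hεδ]
  rw [← Matrix.mul_smul, ← Matrix.smul_mul, ← Matrix.diagonal_smul]
  rfl
end

section
/- Assume n ≥ 1 and let ρ: G → GL_d(ℂ) (d ≥ 1) be a representation whose image acts freely, i.e., det(1 − ρ(g)) ≠ 0 for every g ≠ 1 in G. Let C̃ be the Euclidean Cartan matrix of ρ, the n×n matrix with entries C̃^i_j = (1/|G|) Σ_{k=1}^n |C_k|·χ_i(g_k)·conj(χ_j(g_k))·det(1 − ρ(g_k)), and for 0 ≤ a, b ≤ n let η^a_b := (2·(−1)^d/|G|) · Σ_{k=1}^n |C_k|·χ_a(g_k)·conj(χ_b(g_k)) / det(1 − ρ(g_k)). Then C̃ is invertible and for all 1 ≤ i, j ≤ n its inverse satisfies (C̃^{-1})^i_j = (−1)^d · (d_i·d_j/2) · ( η^0_0 − η^i_0/d_i − η^0_j/d_j + η^i_j/(d_i·d_j) ). -/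
open CategoryTheory
open scoped Classical

open scoped ComplexConjugate

open scoped ComplexOrder in
/-- Weyl's unitary trick: a matrix representation of a finite group over `ℂ` satisfies
`tr M(x⁻¹) = conj (tr M(x))`. -/
theorem Matrix.trace_map_inv_eq_conj {G m : Type*} [Group G] [Fintype G] [Fintype m]
    [DecidableEq m] (M : G →* Matrix m m ℂ) (x : G) :
    (M x⁻¹).trace = conj (M x).trace := by
  set P : Matrix m m ℂ := ∑ y : G, (M y).conjTranspose * M y with hP
  have hPpos : P.PosDef := by
    rw [hP, ← Finset.add_sum_erase Finset.univ _ (Finset.mem_univ (1 : G))]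
    refine Matrix.PosDef.add_posSemidef (by simpa using Matrix.PosDef.one) ?_
    exact Matrix.posSemidef_sum _ fun y _ => Matrix.posSemidef_conjTranspose_mul_self (M y)
  have hinv : (M x).conjTranspose * P * M x = P := by
    rw [hP, Finset.mul_sum, Finset.sum_mul]
    refine Fintype.sum_equiv (Equiv.mulRight x) _ _ fun y => ?_
    simp [Matrix.conjTranspose_mul, Matrix.mul_assoc]
  have hone : M x * M x⁻¹ = 1 := by rw [← map_mul]; simp
  have hdet : IsUnit P.det := (Matrix.isUnit_iff_isUnit_det _).mp hPpos.isUnit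
  have hcomm : (M x).conjTranspose * P = P * M x⁻¹ := by
    calc (M x).conjTranspose * P = (M x).conjTranspose * P * (M x * M x⁻¹) := by
          rw [hone, Matrix.mul_one]
      _ = P * M x⁻¹ := by rw [← Matrix.mul_assoc, hinv]
  have hconj : M x⁻¹ = P⁻¹ * ((M x).conjTranspose * P) := by
    rw [hcomm, Matrix.nonsing_inv_mul_cancel_left _ _ hdet]
  rw [hconj, Matrix.trace_mul_comm, Matrix.mul_assoc, Matrix.mul_nonsing_inv _ hdet,
    Matrix.mul_one, Matrix.trace_conjTranspose]
  rfl

theorem FDRep.char_inv_eq_conj {G : Type} [Group G] [Fintype G] (V : FDRep ℂ G) (x : G) :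
    V.character x⁻¹ = conj (V.character x) := by
  have h := Matrix.trace_map_inv_eq_conj
    ((LinearMap.toMatrixAlgEquiv (Module.finBasis ℂ V)).toMulEquiv.toMonoidHom.comp V.ρ) x
  simp only [FDRep.character, LinearMap.trace_eq_matrix_trace ℂ (Module.finBasis ℂ V)]
  exact h

/-- The sum of a class function over a group, computed on class representatives. -/
theorem sum_eq_sum_classCard {G ι : Type*} [Group G] [Fintype G] [Fintype ι] (g : ι → G)
    (hg : ∀ x : G, ∃! k, IsConj (g k) x) (f : G → ℂ) (hf : ∀ x y, IsConj x y → f x = f y) :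
    ∑ x, f x = ∑ k, (classCard (g k) : ℂ) * f (g k) := by
  calc ∑ x, f x = ∑ x, ∑ k, if IsConj (g k) x then f (g k) else 0 := by
        refine Finset.sum_congr rfl fun x _ => ?_
        obtain ⟨k, hk, huniq⟩ := hg x
        rw [Finset.sum_eq_single k (fun l _ hl => if_neg fun h => hl (huniq l h))
          (fun h => absurd (Finset.mem_univ k) h), if_pos hk, hf _ _ hk]
    _ = ∑ k, (classCard (g k) : ℂ) * f (g k) := by
        rw [Finset.sum_comm]
        refine Finset.sum_congr rfl fun k _ => ?_
        rw [← Finset.sum_filter, Finset.sum_const, nsmul_eq_mul, classCard,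
          Nat.card_eq_fintype_card, Fintype.card_subtype]

theorem FDRep.char_eq_of_isConj {k G : Type} [Field k] [Group G] (V : FDRep k G) {x y : G}
    (h : IsConj x y) : V.character x = V.character y := by
  obtain ⟨c, rfl⟩ := isConj_iff.mp h
  exact (V.char_conj x c).symm

/-- The algebra behind the inversion formula: `X` plays the role of a character table with
weights `w`, and `D` of the values `det (1 - ρ)` away from the identity. -/
theorem cartan_mul_eta_eq_one {n : ℕ} (X : Matrix (Fin (n + 1)) (Fin (n + 1)) ℂ)
    (w : Fin (n + 1) → ℂ) (D : Fin n → ℂ) (hD : ∀ k, D k ≠ 0)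
    (hX0 : ∀ k, X 0 k = 1) (hreal : ∀ i, conj (X i 0) = X i 0)
    (horth : ∀ i j, ∑ k, w k * X i k * conj (X j k) = if i = j then 1 else 0)
    (C A : Matrix (Fin n) (Fin n) ℂ)
    (hC : ∀ i j, C i j = ∑ k : Fin n,
      w k.succ * X i.succ k.succ * conj (X j.succ k.succ) * D k)
    (hA : ∀ i j, A i j = ∑ k : Fin n, w k.succ / D k * (X i.succ 0 - X i.succ k.succ) *
      (X j.succ 0 - conj (X j.succ k.succ))) :
    C * A = 1 := by
  have hdual : ∀ k l, ∑ m, w k * conj (X m k) * X m l = if k = l then 1 else 0 := by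
    have h1 : X * Matrix.of (fun k j => w k * conj (X j k)) = 1 := by
      ext i j
      rw [Matrix.mul_apply, Matrix.one_apply, ← horth i j]
      refine Finset.sum_congr rfl fun k _ => ?_
      simp only [Matrix.of_apply]; ring
    have h2 := mul_eq_one_comm.mp h1
    intro k l
    have := congrFun (congrFun h2 k) l
    rwa [Matrix.mul_apply, Matrix.one_apply] at this
  have hsum : ∀ k l : Fin n, ∑ m : Fin n, w k.succ * conj (X m.succ k.succ) *
      (X m.succ 0 - X m.succ l.succ) = -if k = l then 1 else 0 := by
    intro k l
    have h0 := hdual k.succ 0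
    have hl := hdual k.succ l.succ
    rw [Fin.sum_univ_succ] at h0 hl
    simp only [hX0, Fin.succ_ne_zero, if_false, Fin.succ_inj] at h0 hl
    simp only [mul_sub, Finset.sum_sub_distrib]
    rw [← hl]
    linear_combination h0
  ext i j
  have hi0 := horth i.succ 0
  have hij := horth i.succ j.succ
  rw [Fin.sum_univ_succ] at hi0 hij
  simp only [hX0, map_one, mul_one, Fin.succ_ne_zero, if_false, Fin.succ_inj, hreal] at hi0 hij
  calc (C * A) i j
      = ∑ k : Fin n, ∑ l : Fin n, X i.succ k.succ * D k * (w l.succ / D l) *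
          (X j.succ 0 - conj (X j.succ l.succ)) *
          ∑ m : Fin n, w k.succ * conj (X m.succ k.succ) * (X m.succ 0 - X m.succ l.succ) := by
        simp only [Matrix.mul_apply, hC, hA, Finset.sum_mul_sum]
        simp only [Finset.mul_sum]
        rw [Finset.sum_comm]
        refine Finset.sum_congr rfl fun k _ => ?_
        rw [Finset.sum_comm]
        refine Finset.sum_congr rfl fun l _ => Finset.sum_congr rfl fun m _ => ?_
        ring
    _ = ∑ k : Fin n, -(w k.succ * X i.succ k.succ * (X j.succ 0 - conj (X j.succ k.succ))) := by
        refine Finset.sum_congr rfl fun k _ => ?_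
        simp only [hsum]
        rw [Finset.sum_eq_single k (fun l _ hl => by simp [hl.symm]) (by simp)]
        have := hD k
        simp only [if_true]
        field_simp
    _ = (1 : Matrix (Fin n) (Fin n) ℂ) i j := by
        rw [Matrix.one_apply, ← hij]
        simp only [mul_sub, neg_sub, Finset.sum_sub_distrib, ← Finset.sum_mul]
        linear_combination -X j.succ 0 * hi0

theorem stmt14 {G : Type} [Group G] [Fintype G] {n : ℕ} (hn : 1 ≤ n)
    (g : Fin (n + 1) → G) (hg1 : g 0 = 1)
    (hg : ∀ x : G, ∃! k : Fin (n + 1), IsConj (g k) x)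
    (R : Fin (n + 1) → FDRep ℂ G)
    (hsimple : ∀ i, Simple (R i))
    (htriv : ∀ x : G, (R 0).character x = 1)
    (hdist : ∀ i j, i ≠ j → ¬ Nonempty (R i ≅ R j))
    {d : ℕ} (hd : 1 ≤ d) (ρ : G →* Matrix.GeneralLinearGroup (Fin d) ℂ)
    -- the image of `ρ` acts freely
    (hfree : ∀ x : G, x ≠ 1 →
      Matrix.det ((1 : Matrix (Fin d) (Fin d) ℂ) - (ρ x : Matrix (Fin d) (Fin d) ℂ)) ≠ 0)
    -- `Ct` : the Euclidean Cartan matrix of `ρ`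
    (Ct : Matrix (Fin n) (Fin n) ℂ)
    (hCt : ∀ i j : Fin n, Ct i j =
      (Fintype.card G : ℂ)⁻¹ *
        ∑ k : Fin n, (classCard (g k.succ) : ℂ) *
          (R i.succ).character (g k.succ) *
          (starRingEnd ℂ) ((R j.succ).character (g k.succ)) *
          Matrix.det ((1 : Matrix (Fin d) (Fin d) ℂ) -
            (ρ (g k.succ) : Matrix (Fin d) (Fin d) ℂ)))
    -- `η a b` : the generalized η-invariants
    (η : Fin (n + 1) → Fin (n + 1) → ℂ)
    (hη : ∀ a b, η a b =
      2 * (-1 : ℂ) ^ d / (Fintype.card G : ℂ) *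
        ∑ k : Fin n, (classCard (g k.succ) : ℂ) *
          (R a).character (g k.succ) * (starRingEnd ℂ) ((R b).character (g k.succ)) /
          Matrix.det ((1 : Matrix (Fin d) (Fin d) ℂ) -
            (ρ (g k.succ) : Matrix (Fin d) (Fin d) ℂ)))
    -- `A` : the claimed inverse of `Ct`, expressed through the η-invariants
    (A : Matrix (Fin n) (Fin n) ℂ)
    (hA : ∀ i j : Fin n, A i j =
      (-1 : ℂ) ^ d * ((R i.succ).character 1 * (R j.succ).character 1 / 2) *
        (η 0 0 - η i.succ 0 / (R i.succ).character 1 - η 0 j.succ / (R j.succ).character 1 +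
          η i.succ j.succ / ((R i.succ).character 1 * (R j.succ).character 1))) :
    Ct * A = 1 ∧ A * Ct = 1 := by
  have hcard : (Fintype.card G : ℂ) ≠ 0 := by exact_mod_cast Fintype.card_ne_zero
  have : Invertible (Nat.card G : ℂ) := invertibleOfNonzero (by rwa [Nat.card_eq_fintype_card])
  have horth : ∀ i j, ∑ k, ((Fintype.card G : ℂ)⁻¹ * classCard (g k)) * (R i).character (g k) *
      conj ((R j).character (g k)) = if i = j then 1 else 0 := by
    intro i j
    have := hsimple i
    have := hsimple j
    have h := FDRep.char_orthonormal (R i) (R j)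
    rw [Nat.card_eq_fintype_card] at h
    simp only [FDRep.char_inv_eq_conj] at h
    rw [sum_eq_sum_classCard g hg _ fun x y hxy => by
      rw [(R i).char_eq_of_isConj hxy, (R j).char_eq_of_isConj hxy], Finset.mul_sum] at h
    have hiff : Nonempty (R i ≅ R j) ↔ i = j := by
      refine ⟨fun hne => by_contra fun hij => hdist i j hij hne, ?_⟩
      rintro rfl
      exact ⟨Iso.refl _⟩
    simp only [hiff] at h
    rw [← h]
    exact Finset.sum_congr rfl fun k _ => by ring
  have hdim : ∀ i, (R i).character 1 ≠ 0 := by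
    intro i h0
    have := hsimple i
    rw [FDRep.char_one, Nat.cast_eq_zero, Module.finrank_zero_iff] at h0
    have hzero : ∀ x, (R i).character x = 0 := fun x => by
      rw [FDRep.character, Subsingleton.elim ((R i).ρ x) 0, map_zero]
    simpa [hzero] using horth i i
  have hne : ∀ k : Fin n, g k.succ ≠ 1 := by
    intro k hk
    refine Fin.succ_ne_zero k ((hg 1).unique ?_ ?_)
    · rw [hk]
    · rw [hg1]
  have hCA : Ct * A = 1 := by
    refine cartan_mul_eta_eq_one (fun i k => (R i).character (g k))
      (fun k => (Fintype.card G : ℂ)⁻¹ * classCard (g k)) _ (fun k => hfree _ (hne k))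
      (fun k => htriv _) (fun i => ?_) horth Ct A (fun i j => ?_) (fun i j => ?_)
    · rw [hg1, FDRep.char_one, Complex.conj_natCast]
    · rw [hCt, Finset.mul_sum]
      exact Finset.sum_congr rfl fun k _ => by ring
    · have hi := hdim i.succ
      have hj := hdim j.succ
      have hsign : ((-1 : ℂ) ^ d) * (-1) ^ d = 1 := by rw [← mul_pow]; simp
      rw [hA]
      simp only [hη, htriv, hg1, map_one, Finset.mul_sum, Finset.sum_div,
        ← Finset.sum_sub_distrib, ← Finset.sum_add_distrib]
      refine Finset.sum_congr rfl fun k _ => ?_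
      have hDk := hfree _ (hne k)
      generalize Matrix.det (1 - (ρ (g k.succ) : Matrix (Fin d) (Fin d) ℂ)) = D at hDk ⊢
      generalize (R i.succ).character 1 = a at hi ⊢
      generalize (R j.succ).character 1 = b at hj ⊢
      field_simp
      linear_combination (classCard (g k.succ) : ℂ) * (a - (R i.succ).character (g k.succ)) *
        (b - conj ((R j.succ).character (g k.succ))) * hsign
  exact ⟨hCA, mul_eq_one_comm.mp hCA⟩
end
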